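/- arXiv:1407.0934 — 5 statements merged into one kernel-verified Lean document; each statement's English description precedes it below -/
import Mathlib

section
/- Fix λ₁, λ₂ ∈ ℂ with λ₁·λ₂·(λ₁−λ₂) ≠ 0. The function F_ana on V defined by F_ana(Y,Z) = (Φ_{λ₁}(ν₁)·Φ_{λ₂}(ν₂) − Φ_{λ₁}(ν₂)·Φ_{λ₂}(ν₁))/(ν₁ − ν₂) at every point where ν₁ ≠ ν₂, and by 0 on the null set where ν₁ = ν₂, is locally integrable on V with respect to Lebesgue measure. -/
open MeasureTheory

/-- The entire function `Φ_λ(z) = Σ_{n≥0} (λz)ⁿ/(4ⁿ (n!)²)`. -/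
noncomputable def Phi (lam z : ℂ) : ℂ :=
  ∑' n : ℕ, (lam * z) ^ n / (4 ^ n * (n.factorial : ℂ) ^ 2)

/-- The space `V = M₂(ℝ) × M₂(ℝ)` of pairs of 2×2 real matrices. -/
abbrev V : Type := (Fin 2 → Fin 2 → ℝ) × (Fin 2 → Fin 2 → ℝ)

/-- `Q = tr(YZ)`. -/
noncomputable def Qf (p : V) : ℝ := (Matrix.of p.1 * Matrix.of p.2).trace

/-- `S = det Y · det Z`. -/
noncomputable def Sf (p : V) : ℝ := (Matrix.of p.1).det * (Matrix.of p.2).det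

/-- `S₀ = Q² − 4S`. -/
noncomputable def S0f (p : V) : ℝ := Qf p ^ 2 - 4 * Sf p

/-- `δ = √S₀` if `S₀ ≥ 0`, and `i √(−S₀)` otherwise. -/
noncomputable def deltaC (p : V) : ℂ :=
  if 0 ≤ S0f p then (Real.sqrt (S0f p) : ℂ) else Complex.I * (Real.sqrt (-S0f p) : ℂ)

/-- `ν₁ = (Q + δ)/2`. -/
noncomputable def nu1 (p : V) : ℂ := ((Qf p : ℂ) + deltaC p) / 2

/-- `ν₂ = (Q − δ)/2`. -/
noncomputable def nu2 (p : V) : ℂ := ((Qf p : ℂ) - deltaC p) / 2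

lemma differentiable_Phi (lam : ℂ) : Differentiable ℂ (Phi lam) := by
  intro z
  have hs : Summable fun n : ℕ => (‖lam‖ * (‖z‖ + 1)) ^ n / (n.factorial : ℝ) :=
    Real.summable_pow_div_factorial _
  have hd : DifferentiableOn ℂ (Phi lam) (Metric.ball 0 (‖z‖ + 1)) := by
    refine Complex.differentiableOn_tsum_of_summable_norm hs (fun n => ?_) Metric.isOpen_ball ?_
    · fun_prop
    · intro n w hw
      have hw' : ‖w‖ ≤ ‖z‖ + 1 := by simpa using (mem_ball_zero_iff.1 hw).le
      have hf : (1 : ℝ) ≤ n.factorial := by exact_mod_cast n.factorial_pos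
      have h4 : (1 : ℝ) ≤ 4 ^ n := one_le_pow₀ (by norm_num)
      rw [norm_div, norm_pow, norm_mul, norm_mul, norm_pow, norm_pow]
      simp only [Complex.norm_natCast, Complex.norm_ofNat]
      gcongr
      nlinarith [mul_nonneg (sub_nonneg.2 h4) (sq_nonneg (n.factorial : ℝ))]
  exact hd.differentiableAt (Metric.isOpen_ball.mem_nhds (by simp))

lemma exists_bounds_closedBall_of_differentiable {f : ℂ → ℂ} (hf : Differentiable ℂ f) (R : ℝ) :
    ∃ C, 0 ≤ C ∧ (∀ z ∈ Metric.closedBall (0 : ℂ) R, ‖f z‖ ≤ C) ∧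
      ∀ z ∈ Metric.closedBall (0 : ℂ) R, ∀ w ∈ Metric.closedBall (0 : ℂ) R,
        ‖f z - f w‖ ≤ C * ‖z - w‖ := by
  have hc : Continuous (deriv f) := (hf.contDiff (n := 1)).continuous_deriv le_rfl
  obtain ⟨A, hA⟩ := (isCompact_closedBall (0 : ℂ) R).exists_bound_of_continuousOn
    hf.continuous.continuousOn
  obtain ⟨B, hB⟩ := (isCompact_closedBall (0 : ℂ) R).exists_bound_of_continuousOn hc.continuousOn
  refine ⟨max 0 (max A B), le_max_left _ _, fun z hz => (hA z hz).trans (by simp), ?_⟩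
  intro z hz w hw
  exact (convex_closedBall (0 : ℂ) R).norm_image_sub_le_of_norm_deriv_le
    (fun x _ => hf x) (fun x hx => (hB x hx).trans (by simp)) hw hz

/-- The divided difference of the antisymmetrization of `f ⊗ g` is bounded on bounded sets. -/
lemma exists_bound_antisymm_div_sub {f g : ℂ → ℂ} (hf : Differentiable ℂ f)
    (hg : Differentiable ℂ g) (R : ℝ) :
    ∃ C, ∀ a ∈ Metric.closedBall (0 : ℂ) R, ∀ b ∈ Metric.closedBall (0 : ℂ) R,
      ‖(f a * g b - f b * g a) / (a - b)‖ ≤ C := by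
  obtain ⟨A, hA, hA1, hA2⟩ := exists_bounds_closedBall_of_differentiable hf R
  obtain ⟨B, hB, hB1, hB2⟩ := exists_bounds_closedBall_of_differentiable hg R
  refine ⟨2 * (A * B), fun a ha b hb => ?_⟩
  rw [norm_div]
  refine div_le_of_le_mul₀ (norm_nonneg _) (by positivity) ?_
  calc ‖f a * g b - f b * g a‖ = ‖(f a - f b) * g b - f b * (g a - g b)‖ := by ring_nf
    _ ≤ ‖f a - f b‖ * ‖g b‖ + ‖f b‖ * ‖g a - g b‖ := by
      simpa only [norm_mul] using norm_sub_le ((f a - f b) * g b) (f b * (g a - g b))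
    _ ≤ (A * ‖a - b‖) * B + A * (B * ‖a - b‖) := by
      gcongr
      exacts [hA2 a ha b hb, hB1 b hb, hA1 b hb, hB2 a ha b hb]
    _ = 2 * (A * B) * ‖a - b‖ := by ring

lemma continuous_Qf : Continuous Qf := by
  unfold Qf
  simp only [Matrix.trace_fin_two, Matrix.mul_apply, Fin.sum_univ_two, Matrix.of_apply]
  fun_prop

lemma continuous_S0f : Continuous S0f := by
  have hS : Continuous Sf := by
    unfold Sf
    simp only [Matrix.det_fin_two, Matrix.of_apply]
    fun_prop
  have hQ := continuous_Qf
  unfold S0f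
  fun_prop

lemma measurable_deltaC : Measurable deltaC := by
  have hS := continuous_S0f.measurable
  unfold deltaC
  exact Measurable.ite (measurableSet_le measurable_const hS) (by fun_prop) (by fun_prop)

lemma norm_deltaC (p : V) : ‖deltaC p‖ = √|S0f p| := by
  unfold deltaC
  split_ifs with h
  · simp [abs_of_nonneg h, abs_of_nonneg (Real.sqrt_nonneg _)]
  · simp [abs_of_neg (not_le.1 h), abs_of_nonneg (Real.sqrt_nonneg _)]

lemma norm_nu1_le (p : V) : ‖nu1 p‖ ≤ (|Qf p| + √|S0f p|) / 2 := by
  rw [nu1, norm_div, Complex.norm_ofNat, ← norm_deltaC, ← Real.norm_eq_abs, ← Complex.norm_real]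
  gcongr
  exact norm_add_le _ _

lemma norm_nu2_le (p : V) : ‖nu2 p‖ ≤ (|Qf p| + √|S0f p|) / 2 := by
  rw [nu2, norm_div, Complex.norm_ofNat, ← norm_deltaC, ← Real.norm_eq_abs, ← Complex.norm_real]
  gcongr
  exact norm_sub_le _ _

lemma measurable_nu1 : Measurable nu1 := by
  have hQ := continuous_Qf.measurable
  have hd := measurable_deltaC
  unfold nu1
  fun_prop

lemma measurable_nu2 : Measurable nu2 := by
  have hQ := continuous_Qf.measurable
  have hd := measurable_deltaC
  unfold nu2
  fun_prop

/-- The function `F_ana` is locally integrable on `V`. -/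
theorem Fana_locallyIntegrable (l1 l2 : ℂ) (h : l1 * l2 * (l1 - l2) ≠ 0) :
    LocallyIntegrable (fun p : V =>
      if nu1 p ≠ nu2 p then
        (Phi l1 (nu1 p) * Phi l2 (nu2 p) - Phi l1 (nu2 p) * Phi l2 (nu1 p)) / (nu1 p - nu2 p)
      else 0) volume := by
  have hdiv : (fun p : V => if nu1 p ≠ nu2 p then
        (Phi l1 (nu1 p) * Phi l2 (nu2 p) - Phi l1 (nu2 p) * Phi l2 (nu1 p)) / (nu1 p - nu2 p)
      else 0) = fun p : V =>
        (Phi l1 (nu1 p) * Phi l2 (nu2 p) - Phi l1 (nu2 p) * Phi l2 (nu1 p)) /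
          (nu1 p - nu2 p) := by
    ext p
    split_ifs with hp
    · rfl
    · simp [not_not.1 hp]
  rw [hdiv]
  have h1 := (differentiable_Phi l1).continuous.measurable
  have h2 := (differentiable_Phi l2).continuous.measurable
  have hn1 := measurable_nu1
  have hn2 := measurable_nu2
  intro p
  refine ⟨Metric.closedBall p 1, Metric.closedBall_mem_nhds p one_pos, ?_⟩
  have hcont : Continuous fun q : V => (|Qf q| + √|S0f q|) / 2 := by
    have hQ := continuous_Qf
    have hS := continuous_S0f
    fun_prop
  obtain ⟨R, hR⟩ := (isCompact_closedBall p 1).exists_bound_of_continuousOn hcont.continuousOn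
  obtain ⟨C, hC⟩ := exists_bound_antisymm_div_sub (differentiable_Phi l1) (differentiable_Phi l2) R
  refine Measure.integrableOn_of_bounded (M := C)
    (isCompact_closedBall p 1).measure_lt_top.ne
    (Measurable.aestronglyMeasurable (by fun_prop)) ?_
  refine (ae_restrict_iff' Metric.isClosed_closedBall.measurableSet).2 (.of_forall fun q hq => ?_)
  have hq' := (le_abs_self _).trans (hR q hq)
  exact hC _ (mem_closedBall_zero_iff.2 ((norm_nu1_le q).trans hq'))
    _ (mem_closedBall_zero_iff.2 ((norm_nu2_le q).trans hq'))
end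

section
/- Let r, m ≥ 1, k ∈ ℕ, and let T be a ℂ-linear functional on functions ℝ^r × ℝ^m → ℂ (only its values on smooth compactly supported functions are used). Assume that for every multi-index α ∈ ℕ^r with |α| = k and every smooth compactly supported φ : ℝ^r × ℝ^m → ℂ, T((x,y) ↦ x^α·φ(x/ε,y)) → 0 as ε → 0⁺. Then for every i ∈ {1,…,r}, every multi-index α ∈ ℕ^r with |α| = k+1, and every smooth compactly supported φ, T((x,y) ↦ ∂/∂x_i [x^α·φ(x/ε,y)]) → 0 as ε → 0⁺. (Equivalently: if the distribution T has degree of singularity at most k along {0} × ℝ^m, then its partial derivative ∂T/∂x_i has degree of singularity at most k+1, since ⟨x^α·(∂T/∂x_i), φ_ε⟩ = −T(∂/∂x_i(x^α φ_ε)).) -/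
open MeasureTheory Filter

section Monomial

variable {ι : Type*} [Fintype ι] [DecidableEq ι]

lemma sum_sub_single {α : ι → ℕ} {j : ι} (hj : α j ≠ 0) {k : ℕ} (hα : ∑ l, α l = k + 1) :
    ∑ l, (α - Pi.single j 1 : ι → ℕ) l = k := by
  have hsplit : α = (α - Pi.single j 1 : ι → ℕ) + Pi.single j 1 := by
    ext l
    rcases eq_or_ne l j with rfl | hl
    · simp; omega
    · simp [hl]
  rw [hsplit] at hα
  simpa [Finset.sum_add_distrib] using hα

lemma prod_pow_sub_single {α : ι → ℕ} {j : ι} (hj : α j ≠ 0) (x : ι → ℂ) :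
    ∏ l, x l ^ α l = (∏ l, x l ^ (α - Pi.single j 1 : ι → ℕ) l) * x j := by
  rw [← Finset.prod_erase_mul _ _ (Finset.mem_univ j)]
  conv_rhs => rw [← Finset.prod_erase_mul _ _ (Finset.mem_univ j), mul_assoc]
  congr 1
  · refine Finset.prod_congr rfl fun l hl => ?_
    simp [Finset.ne_of_mem_erase hl]
  · simp [pow_sub_one_mul hj]

lemma hasDerivAt_prod_pow_line (α : ι → ℕ) (i : ι) (x : ι → ℝ) :
    HasDerivAt (fun t : ℝ => ∏ l, (((x + t • Pi.single i (1 : ℝ) : ι → ℝ) l : ℝ) : ℂ) ^ α l)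
      (α i * ∏ l, (x l : ℂ) ^ (α - Pi.single i 1 : ι → ℕ) l) 0 := by
  have hfactor : (fun t : ℝ => ∏ l, (((x + t • Pi.single i (1 : ℝ) : ι → ℝ) l : ℝ) : ℂ) ^ α l) =
      fun t : ℝ => (∏ l ∈ Finset.univ.erase i, (x l : ℂ) ^ α l) * ((x i : ℂ) + t) ^ α i := by
    ext t
    rw [← Finset.prod_erase_mul _ _ (Finset.mem_univ i)]
    congr 1
    · refine Finset.prod_congr rfl fun l hl => ?_
      simp [Finset.ne_of_mem_erase hl]
    · simp
  rw [hfactor]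
  have hpow := (((Complex.ofRealCLM.hasDerivAt (x := (0 : ℝ))).const_add (x i : ℂ)).pow
    (α i)).const_mul (∏ l ∈ Finset.univ.erase i, (x l : ℂ) ^ α l)
  refine hpow.congr_deriv ?_
  conv_rhs => rw [← Finset.prod_erase_mul _ _ (Finset.mem_univ i)]
  have hprod : ∏ l ∈ Finset.univ.erase i, (x l : ℂ) ^ (α - Pi.single i 1 : ι → ℕ) l =
      ∏ l ∈ Finset.univ.erase i, (x l : ℂ) ^ α l := by
    refine Finset.prod_congr rfl fun l hl => ?_
    simp [Finset.ne_of_mem_erase hl]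
  rw [hprod]
  simp
  ring

lemma fderiv_monomial_mul_dilation {F : Type*} [NormedAddCommGroup F] [NormedSpace ℝ F]
    {α : ι → ℕ} {j : ι} (hj : α j ≠ 0) (i : ι) {φ : (ι → ℝ) × F → ℂ}
    (hφ : Differentiable ℝ φ) (ε : ℝ) (p : (ι → ℝ) × F) :
    fderiv ℝ (fun q : (ι → ℝ) × F => (∏ l, (q.1 l : ℂ) ^ α l) * φ (fun l => q.1 l / ε, q.2))
        p (Pi.single i 1, 0) =
      α i * ((∏ l, (p.1 l : ℂ) ^ (α - Pi.single i 1 : ι → ℕ) l) * φ (fun l => p.1 l / ε, p.2)) +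
      (∏ l, (p.1 l : ℂ) ^ (α - Pi.single j 1 : ι → ℕ) l) *
        (((p.1 j / ε : ℝ) : ℂ) *
          fderiv ℝ φ (fun l => p.1 l / ε, p.2) (Pi.single i 1, 0)) := by
  have hdiff : Differentiable ℝ
      (fun q : (ι → ℝ) × F => (∏ l, (q.1 l : ℂ) ^ α l) * φ (fun l => q.1 l / ε, q.2)) := by
    refine Differentiable.mul (ContDiff.differentiable (n := 1) (contDiff_prod fun l _ => ?_)
      one_ne_zero) (hφ.comp ?_)
    · exact (Complex.ofRealCLM.contDiff.comp (by fun_prop)).pow _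
    · fun_prop
  rw [← (hdiff p).lineDeriv_eq_fderiv]
  have hline : HasDerivAt
      (fun t : ℝ => φ (fun l => (p.1 + t • Pi.single i (1 : ℝ) : ι → ℝ) l / ε, p.2))
      (fderiv ℝ φ (fun l => p.1 l / ε, p.2) ((1 / ε) • (Pi.single i 1, 0))) 0 := by
    have hφline := (hφ (fun l => p.1 l / ε, p.2)).hasFDerivAt.hasLineDerivAt
      ((1 / ε) • (Pi.single i 1, 0))
    refine HasDerivAt.congr_of_eventuallyEq hφline (.of_forall fun t => ?_)
    refine congrArg φ (Prod.ext (funext fun l => ?_) ?_)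
    · simp [div_eq_mul_inv]; ring
    · simp
  have hmul := (hasDerivAt_prod_pow_line α i p.1).mul hline
  rw [lineDeriv, (HasDerivAt.congr_of_eventuallyEq hmul
    (.of_forall fun t => by simp)).deriv, map_smul]
  simp only [zero_smul, add_zero, Complex.real_smul]
  rw [prod_pow_sub_single hj]
  push_cast
  ring

end Monomial

/-- If a distribution `T` on `ℝ^r × ℝ^m` has degree of singularity at most `k`
along `{0} × ℝ^m` (i.e. `⟨x^α T, φ_ε⟩ → 0` as `ε → 0⁺` for all `|α| = k`),
then for each `i` the partial derivative `∂T/∂x_i` has degree of singularity at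
most `k+1`, where `⟨x^α (∂T/∂x_i), φ_ε⟩ = −T(∂/∂x_i (x^α φ_ε))`. -/
theorem degree_of_singularity_deriv (r m : ℕ) (hr : 1 ≤ r) (hm : 1 ≤ m) (k : ℕ)
    (T : (((Fin r → ℝ) × (Fin m → ℝ)) → ℂ) →ₗ[ℂ] ℂ)
    (hT : ∀ α : Fin r → ℕ, (∑ i, α i) = k →
      ∀ φ : ((Fin r → ℝ) × (Fin m → ℝ)) → ℂ, ContDiff ℝ (⊤ : ℕ∞) φ → HasCompactSupport φ →
        Tendsto (fun ε : ℝ =>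
            T (fun p => (∏ i, (p.1 i : ℂ) ^ α i) * φ (fun i => p.1 i / ε, p.2)))
          (nhdsWithin 0 (Set.Ioi 0)) (nhds 0)) :
    ∀ i : Fin r, ∀ α : Fin r → ℕ, (∑ j, α j) = k + 1 →
      ∀ φ : ((Fin r → ℝ) × (Fin m → ℝ)) → ℂ, ContDiff ℝ (⊤ : ℕ∞) φ → HasCompactSupport φ →
        Tendsto (fun ε : ℝ =>
            T (fun p => fderiv ℝ
              (fun q : (Fin r → ℝ) × (Fin m → ℝ) =>
                (∏ j, (q.1 j : ℂ) ^ α j) * φ (fun j => q.1 j / ε, q.2))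
              p (Pi.single i 1, 0)))
          (nhdsWithin 0 (Set.Ioi 0)) (nhds 0) := by
  intro i α hα φ hφ hφc
  obtain ⟨j, hj⟩ : ∃ j, α j ≠ 0 := by
    by_contra! h
    simp [h] at hα
  let ψ : (Fin r → ℝ) × (Fin m → ℝ) → ℂ :=
    fun q => (q.1 j : ℂ) * fderiv ℝ φ q (Pi.single i 1, 0)
  have hψs : ContDiff ℝ (⊤ : ℕ∞) ψ :=
    (Complex.ofRealCLM.contDiff.comp (by fun_prop)).mul
      ((hφ.fderiv_right (by simp)).clm_apply contDiff_const)
  have hψc : HasCompactSupport ψ := (hφc.fderiv_apply (𝕜 := ℝ) _).mul_left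
  have hlow : Tendsto (fun ε : ℝ => (α i : ℂ) *
      T (fun p => (∏ l, (p.1 l : ℂ) ^ (α - Pi.single i 1 : Fin r → ℕ) l) * φ (fun l => p.1 l / ε, p.2)))
      (nhdsWithin 0 (Set.Ioi 0)) (nhds 0) := by
    by_cases hi : α i = 0
    · simp [hi]
    · simpa using (hT _ (sum_sub_single hi hα) φ hφ hφc).const_mul (α i : ℂ)
  have hsum := hlow.add (hT _ (sum_sub_single hj hα) ψ hψs hψc)
  rw [add_zero] at hsum
  refine hsum.congr fun ε => ?_
  rw [← smul_eq_mul, ← map_smul, ← map_add]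
  congr 1
  ext p
  exact (fderiv_monomial_mul_dilation hj i (hφ.differentiable (by simp)) ε p).symm
end

section
/- Let r, m ≥ 1, let α ∈ ℕ^r be a multi-index, and let S be a ℂ-linear functional on functions ℝ^m → ℂ such that S(ψ) ≠ 0 for some smooth compactly supported ψ : ℝ^m → ℂ. Define T on smooth compactly supported functions φ : ℝ^r × ℝ^m → ℂ by T(φ) = (−1)^{|α|}·S(y ↦ (∂^α_x φ)(0,y)) (this is the distribution δ₀^{(α)} ⊗ S). Then: (i) for every multi-index β ∈ ℕ^r with |β| = |α|+1, every smooth compactly supported φ, and every ε > 0, T((x,y) ↦ x^β·φ(x/ε,y)) = 0; (ii) there exist a multi-index β with |β| = |α| and a smooth compactly supported φ such that ε ↦ T((x,y) ↦ x^β·φ(x/ε,y)) is a nonzero constant function of ε > 0. Consequently δ₀^{(α)} ⊗ S has degree of singularity exactly |α|+1 along {0} × ℝ^m. -/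
open MeasureTheory Filter

/-- `n`-fold directional derivative in direction `v`. -/
noncomputable def dirDerivPow {E : Type*} [NormedAddCommGroup E] [NormedSpace ℝ E]
    (v : E) : ℕ → (E → ℂ) → (E → ℂ)
  | 0, f => f
  | n + 1, f => fun p => fderiv ℝ (dirDerivPow v n f) p v

/-- The multi-partial derivative `∂^α_x` in the first (ℝ^r) variable. -/
noncomputable def multiPartial (r m : ℕ) (α : Fin r → ℕ)
    (f : ((Fin r → ℝ) × (Fin m → ℝ)) → ℂ) : ((Fin r → ℝ) × (Fin m → ℝ)) → ℂ :=
  (List.finRange r).foldr (fun i g => dirDerivPow ((Pi.single i 1 : Fin r → ℝ), 0) (α i) g) f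

section DirectionalDerivatives

variable {r m : ℕ}

theorem dirDerivPow_eventuallyEq {E : Type*} [NormedAddCommGroup E] [NormedSpace ℝ E]
    (v : E) (n : ℕ) {f g : E → ℂ} {p : E} (h : f =ᶠ[nhds p] g) :
    dirDerivPow v n f =ᶠ[nhds p] dirDerivPow v n g := by
  induction n with
  | zero => exact h
  | succ n ih =>
    filter_upwards [ih.fderiv (𝕜 := ℝ)] with q hq
    simp only [dirDerivPow, hq]

theorem multiPartial_eq_of_eventuallyEq (α : Fin r → ℕ)
    {f g : (Fin r → ℝ) × (Fin m → ℝ) → ℂ} {p : (Fin r → ℝ) × (Fin m → ℝ)}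
    (h : f =ᶠ[nhds p] g) : multiPartial r m α f p = multiPartial r m α g p := by
  suffices H : ∀ l : List (Fin r),
      l.foldr (fun i g => dirDerivPow ((Pi.single i 1 : Fin r → ℝ), (0 : Fin m → ℝ)) (α i) g) f
        =ᶠ[nhds p]
      l.foldr (fun i g => dirDerivPow ((Pi.single i 1 : Fin r → ℝ), 0) (α i) g) g from
    (H _).eq_of_nhds
  intro l
  induction l with
  | nil => exact h
  | cons i l ih => exact dirDerivPow_eventuallyEq _ _ ih

/-- Leibniz rule for the product of a power of a coordinate and a differentiable function. -/
theorem fderiv_coord_pow_mul (j : Fin r) (k : ℕ) {g : (Fin r → ℝ) × (Fin m → ℝ) → ℂ}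
    {p : (Fin r → ℝ) × (Fin m → ℝ)} (hg : DifferentiableAt ℝ g p)
    (v : (Fin r → ℝ) × (Fin m → ℝ)) :
    fderiv ℝ (fun q => (q.1 j : ℂ) ^ k * g q) p v =
      (p.1 j : ℂ) ^ k * fderiv ℝ g p v + k * (p.1 j : ℂ) ^ (k - 1) * (v.1 j : ℂ) * g p := by
  have hL : HasFDerivAt (fun q : (Fin r → ℝ) × (Fin m → ℝ) => (q.1 j : ℂ))
      (Complex.ofRealCLM ∘L ContinuousLinearMap.proj j ∘L
        ContinuousLinearMap.fst ℝ (Fin r → ℝ) (Fin m → ℝ)) p :=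
    (Complex.ofRealCLM ∘L (ContinuousLinearMap.proj (R := ℝ) (φ := fun _ : Fin r => ℝ) j) ∘L
        ContinuousLinearMap.fst ℝ (Fin r → ℝ) (Fin m → ℝ)).hasFDerivAt
  have hprod : HasFDerivAt (fun q => (q.1 j : ℂ) ^ k * g q) _ p := (hL.pow k).mul hg.hasFDerivAt
  rw [hprod.fderiv]
  simp
  ring

/-- `f` is the product of `x_j ^ k` and a smooth function. -/
def IsSmoothMultipleOfPow (j : Fin r) (k : ℕ) (f : (Fin r → ℝ) × (Fin m → ℝ) → ℂ) : Prop :=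
  ∃ g : (Fin r → ℝ) × (Fin m → ℝ) → ℂ,
    ContDiff ℝ (⊤ : ℕ∞) g ∧ f = fun p => (p.1 j : ℂ) ^ k * g p

theorem contDiff_coord (j : Fin r) :
    ContDiff ℝ (⊤ : ℕ∞) (fun q : (Fin r → ℝ) × (Fin m → ℝ) => (q.1 j : ℂ)) :=
  Complex.ofRealCLM.contDiff.comp (by fun_prop)

theorem contDiff_fderiv_apply {E : Type*} [NormedAddCommGroup E] [NormedSpace ℝ E]
    {g : E → ℂ} (hg : ContDiff ℝ (⊤ : ℕ∞) g) (v : E) :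
    ContDiff ℝ (⊤ : ℕ∞) (fun p => fderiv ℝ g p v) :=
  (hg.fderiv_right (m := (⊤ : ℕ∞)) (by simp)).clm_apply contDiff_const

theorem IsSmoothMultipleOfPow.dirDerivPow_of_ne {i j : Fin r} (hij : i ≠ j) {k : ℕ}
    {f : (Fin r → ℝ) × (Fin m → ℝ) → ℂ} (hf : IsSmoothMultipleOfPow j k f) (n : ℕ) :
    IsSmoothMultipleOfPow j k (dirDerivPow (Pi.single i 1, 0) n f) := by
  induction n with
  | zero => exact hf
  | succ n ih =>
    obtain ⟨g, hg, hfg⟩ := ih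
    refine ⟨_, contDiff_fderiv_apply hg (Pi.single i 1, 0), ?_⟩
    funext p
    simp only [dirDerivPow, hfg]
    rw [fderiv_coord_pow_mul _ _ (hg.differentiable (by simp) p)]
    simp [hij.symm]

theorem IsSmoothMultipleOfPow.dirDerivPow_self {j : Fin r} {k n : ℕ}
    {f : (Fin r → ℝ) × (Fin m → ℝ) → ℂ} (hf : IsSmoothMultipleOfPow j (k + n) f) :
    IsSmoothMultipleOfPow j k (dirDerivPow (Pi.single j 1, 0) n f) := by
  induction n generalizing k with
  | zero => exact hf
  | succ n ih =>
    obtain ⟨g, hg, hfg⟩ := ih (k := k + 1) (by rwa [add_right_comm, add_assoc])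
    refine ⟨fun p => (p.1 j : ℂ) * fderiv ℝ g p (Pi.single j 1, 0) + (k + 1) * g p,
      ((contDiff_coord j).mul (contDiff_fderiv_apply hg _)).add (contDiff_const.mul hg), ?_⟩
    funext p
    simp only [dirDerivPow, hfg]
    rw [fderiv_coord_pow_mul _ _ (hg.differentiable (by simp) p)]
    simp
    ring

theorem IsSmoothMultipleOfPow.multiPartial {j : Fin r} {k : ℕ} (α : Fin r → ℕ)
    {f : (Fin r → ℝ) × (Fin m → ℝ) → ℂ} (hf : IsSmoothMultipleOfPow j (k + α j) f) :
    IsSmoothMultipleOfPow j k (multiPartial r m α f) := by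
  suffices H : ∀ (l : List (Fin r)) (k : ℕ), IsSmoothMultipleOfPow j (k + l.count j * α j) f →
      IsSmoothMultipleOfPow j k
        (l.foldr (fun i g => dirDerivPow ((Pi.single i 1 : Fin r → ℝ), 0) (α i) g) f) by
    refine H _ k ?_
    rwa [List.count_eq_one_of_mem (List.nodup_finRange r) (List.mem_finRange j), one_mul]
  intro l
  induction l with
  | nil => intro k h; simpa using h
  | cons i l ih =>
    intro k h
    by_cases hij : i = j
    · subst hij
      refine (ih (k + α i) ?_).dirDerivPow_self
      convert h using 1
      simp
      ring
    · refine (ih k ?_).dirDerivPow_of_ne hij _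
      simpa [List.count_cons, hij] using h

/-- Differentiating `x_i ^ k * g` repeatedly along `x_i`, where `g` does not depend on `x_i`. -/
theorem dirDerivPow_coord_pow_mul (i : Fin r) (k n : ℕ)
    {g : (Fin r → ℝ) × (Fin m → ℝ) → ℂ} (hg : Differentiable ℝ g)
    (hi : ∀ p (t : ℝ), g (p + t • (Pi.single i 1, 0)) = g p) :
    dirDerivPow (Pi.single i 1, 0) n (fun p => (p.1 i : ℂ) ^ k * g p) =
      fun p => (k.descFactorial n : ℂ) * ((p.1 i : ℂ) ^ (k - n) * g p) := by
  have hzero : ∀ p, fderiv ℝ g p (Pi.single i 1, 0) = 0 := by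
    intro p
    rw [← (hg p).lineDeriv_eq_fderiv, lineDeriv]
    simp only [hi, deriv_const]
  induction n with
  | zero => simp [dirDerivPow]
  | succ n ih =>
    funext p
    simp only [dirDerivPow, ih]
    have hd : DifferentiableAt ℝ (fun p => (p.1 i : ℂ) ^ (k - n) * g p) p :=
      ((((contDiff_coord i).differentiable (by simp)).pow _).mul hg) p
    rw [fderiv_const_mul hd, smul_apply, fderiv_coord_pow_mul _ _ (hg p),
      hzero, Nat.descFactorial_succ, Nat.sub_sub]
    simp
    ring

theorem multiPartial_monomial_mul (α : Fin r → ℕ) {ψ : (Fin m → ℝ) → ℂ}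
    (hψ : Differentiable ℝ ψ) (p : (Fin r → ℝ) × (Fin m → ℝ)) :
    multiPartial r m α (fun p => (∏ j, (p.1 j : ℂ) ^ α j) * ψ p.2) p =
      (∏ j, ((α j).factorial : ℂ)) * ψ p.2 := by
  suffices H : ∀ l : List (Fin r), l.Nodup →
      l.foldr (fun i g => dirDerivPow ((Pi.single i 1 : Fin r → ℝ), 0) (α i) g)
        (fun p : (Fin r → ℝ) × (Fin m → ℝ) => (∏ j, (p.1 j : ℂ) ^ α j) * ψ p.2) =
      fun p => (∏ j, if j ∈ l then ((α j).factorial : ℂ) else (p.1 j : ℂ) ^ α j) * ψ p.2 by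
    rw [multiPartial, H _ (List.nodup_finRange r)]
    simp
  intro l hl
  induction l with
  | nil => simp
  | cons i l ih =>
    obtain ⟨hi, hl⟩ := List.nodup_cons.mp hl
    rw [List.foldr_cons, ih hl]
    have split : (fun p : (Fin r → ℝ) × (Fin m → ℝ) =>
        (∏ j, if j ∈ l then ((α j).factorial : ℂ) else (p.1 j : ℂ) ^ α j) * ψ p.2) =
        fun p => (p.1 i : ℂ) ^ α i * ((∏ j ∈ Finset.univ.erase i,
          if j ∈ l then ((α j).factorial : ℂ) else (p.1 j : ℂ) ^ α j) * ψ p.2) := by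
      funext p
      rw [← Finset.mul_prod_erase _ _ (Finset.mem_univ i), if_neg hi, mul_assoc]
    rw [split, dirDerivPow_coord_pow_mul]
    · funext p
      rw [← Finset.mul_prod_erase _ _ (Finset.mem_univ i), if_pos List.mem_cons_self,
        Nat.descFactorial_self, Nat.sub_self, pow_zero, one_mul, mul_assoc]
      congr 2
      refine Finset.prod_congr rfl fun j hj => ?_
      simp [Finset.ne_of_mem_erase hj]
    · refine Differentiable.mul ?_ (hψ.comp differentiable_snd)
      refine (contDiff_prod (n := (⊤ : ℕ∞)) fun j _ => ?_).differentiable (by simp)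
      split_ifs
      · exact contDiff_const
      · exact (contDiff_coord j).pow _
    · intro p t
      congr 1
      · refine Finset.prod_congr rfl fun j hj => ?_
        simp [Finset.ne_of_mem_erase hj]
      · simp

end DirectionalDerivatives


/-- The distribution `δ₀^{(α)} ⊗ S`, with `S ≠ 0`, has degree of singularity exactly
`|α| + 1` along `{0} × ℝ^m`: (i) `x^β (δ₀^{(α)} ⊗ S)` kills every dilated test
function when `|β| = |α| + 1`; (ii) for some `β` with `|β| = |α|` the pairings
`⟨x^β (δ₀^{(α)} ⊗ S), φ_ε⟩` form a nonzero constant function of `ε > 0`. -/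
theorem degree_of_singularity_dirac_tensor (r m : ℕ) (hr : 1 ≤ r) (hm : 1 ≤ m)
    (α : Fin r → ℕ) (S : ((Fin m → ℝ) → ℂ) →ₗ[ℂ] ℂ)
    (hS : ∃ ψ : (Fin m → ℝ) → ℂ, ContDiff ℝ (⊤ : ℕ∞) ψ ∧ HasCompactSupport ψ ∧ S ψ ≠ 0) :
    (∀ β : Fin r → ℕ, (∑ j, β j) = (∑ j, α j) + 1 →
      ∀ φ : ((Fin r → ℝ) × (Fin m → ℝ)) → ℂ, ContDiff ℝ (⊤ : ℕ∞) φ → HasCompactSupport φ →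
      ∀ ε : ℝ, 0 < ε →
        (-1 : ℂ) ^ (∑ j, α j) *
          S (fun y => multiPartial r m α
              (fun p => (∏ j, (p.1 j : ℂ) ^ β j) * φ (fun j => p.1 j / ε, p.2)) (0, y))
          = 0) ∧
    (∃ β : Fin r → ℕ, (∑ j, β j) = (∑ j, α j) ∧
      ∃ φ : ((Fin r → ℝ) × (Fin m → ℝ)) → ℂ, ContDiff ℝ (⊤ : ℕ∞) φ ∧ HasCompactSupport φ ∧
      ∃ c : ℂ, c ≠ 0 ∧
        ∀ ε : ℝ, 0 < ε →
          (-1 : ℂ) ^ (∑ j, α j) *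
            S (fun y => multiPartial r m α
                (fun p => (∏ j, (p.1 j : ℂ) ^ β j) * φ (fun j => p.1 j / ε, p.2)) (0, y))
            = c) := by
  obtain ⟨ψ, hψ, hψc, hSψ⟩ := hS
  refine ⟨?_, α, rfl, ?_⟩
  · intro β hβ φ hφ _ ε _
    obtain ⟨j, hj⟩ : ∃ j, α j < β j := by
      by_contra! h
      have := Finset.sum_le_sum fun j (_ : j ∈ Finset.univ) => h j
      omega
    have hdil : ContDiff ℝ (⊤ : ℕ∞)
        (fun p : (Fin r → ℝ) × (Fin m → ℝ) => φ (fun j => p.1 j / ε, p.2)) :=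
      hφ.comp (by fun_prop)
    have hf : IsSmoothMultipleOfPow j (β j - α j + α j)
        (fun p : (Fin r → ℝ) × (Fin m → ℝ) =>
          (∏ j, (p.1 j : ℂ) ^ β j) * φ (fun j => p.1 j / ε, p.2)) := by
      refine ⟨fun p => (∏ i ∈ Finset.univ.erase j, (p.1 i : ℂ) ^ β i) *
        φ (fun j => p.1 j / ε, p.2),
        (contDiff_prod fun i _ => (contDiff_coord i).pow _).mul hdil, ?_⟩
      funext p
      rw [← Finset.mul_prod_erase _ _ (Finset.mem_univ j), Nat.sub_add_cancel hj.le, mul_assoc]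
    obtain ⟨g, -, hg⟩ := hf.multiPartial α
    have hzero : (fun y => multiPartial r m α
        (fun p => (∏ j, (p.1 j : ℂ) ^ β j) * φ (fun j => p.1 j / ε, p.2)) (0, y)) = 0 := by
      funext y
      rw [hg]
      simp [(Nat.sub_pos_of_lt hj).ne']
    rw [hzero, map_zero, mul_zero]
  · let χ : ContDiffBump (0 : Fin r → ℝ) := ⟨1, 2, one_pos, one_lt_two⟩
    refine ⟨fun p => (χ p.1 : ℂ) * ψ p.2, ?_, ?_,
      (-1 : ℂ) ^ (∑ j, α j) * ((∏ j, ((α j).factorial : ℂ)) * S ψ), ?_, ?_⟩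
    · exact (Complex.ofRealCLM.contDiff.comp (χ.contDiff.comp contDiff_fst)).mul
        (hψ.comp contDiff_snd)
    · refine HasCompactSupport.intro (χ.hasCompactSupport.isCompact.prod hψc.isCompact) ?_
      rintro ⟨x, y⟩ hxy
      by_cases hx : x ∈ tsupport χ
      · have hy : y ∉ tsupport ψ := fun hy => hxy ⟨hx, hy⟩
        simp [image_eq_zero_of_notMem_tsupport hy]
      · simp [image_eq_zero_of_notMem_tsupport hx]
    · have hfact : (∏ j, ((α j).factorial : ℂ)) ≠ 0 :=
        Finset.prod_ne_zero_iff.mpr fun j _ => Nat.cast_ne_zero.mpr (Nat.factorial_ne_zero _)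
      exact mul_ne_zero (pow_ne_zero _ (by simp)) (mul_ne_zero hfact hSψ)
    · intro ε _
      have heq : (fun y => multiPartial r m α (fun p => (∏ j, (p.1 j : ℂ) ^ α j) *
          ((χ (fun j => p.1 j / ε) : ℂ) * ψ p.2)) (0, y)) =
          (∏ j, ((α j).factorial : ℂ)) • ψ := by
        funext y
        have hone : ∀ᶠ p : (Fin r → ℝ) × (Fin m → ℝ) in nhds (0, y),
            χ (fun j => p.1 j / ε) = 1 := by
          have hcont : ContinuousAt
              (fun p : (Fin r → ℝ) × (Fin m → ℝ) => fun j => p.1 j / ε) (0, y) := by fun_prop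
          have hbump : ∀ᶠ x in nhds (fun j => (0 : Fin r → ℝ) j / ε), χ x = 1 := by
            have h0 : (fun j => (0 : Fin r → ℝ) j / ε) = 0 := by ext; simp
            rw [h0]
            exact χ.eventuallyEq_one
          exact hcont.eventually hbump
        rw [multiPartial_eq_of_eventuallyEq α
          (g := fun p => (∏ j, (p.1 j : ℂ) ^ α j) * ψ p.2),
          multiPartial_monomial_mul α (hψ.differentiable (by simp))]
        · rfl
        · filter_upwards [hone] with p hp
          simp [hp]
      rw [heq, map_smul, smul_eq_mul]
end

section
/- For every λ ∈ ℂ, the function W_λ(z) = w_λ(z) + Log(z)·Φ_λ(z), where Log is the principal branch of the logarithm, satisfies 4·(z·W_λ″(z) + W_λ′(z)) = λ·W_λ(z) for all z ∈ ℂ ∖ (−∞, 0]. -/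
/-- `a(n) = −2 Γ′(n+1)/Γ(n+1)` where `Γ` is the real Gamma function. -/
noncomputable def aCoef (n : ℕ) : ℝ :=
  -2 * deriv Real.Gamma ((n : ℝ) + 1) / Real.Gamma ((n : ℝ) + 1)

/-- The entire function `w_λ(z) = Σ_{n≥0} a(n) (λz)ⁿ/(4ⁿ (n!)²)`. -/
noncomputable def wFun (lam z : ℂ) : ℂ :=
  ∑' n : ℕ, (aCoef n : ℂ) * (lam * z) ^ n / (4 ^ n * (n.factorial : ℂ) ^ 2)

/-- `W_λ(z) = w_λ(z) + Log(z) Φ_λ(z)` with the principal branch of the logarithm. -/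
noncomputable def W (lam z : ℂ) : ℂ := wFun lam z + Complex.log z * Phi lam z

/-- The coefficients of the termwise derivative of a power series. -/
def derivCoeff (c : ℕ → ℂ) (n : ℕ) : ℂ := (n + 1) * c (n + 1)

lemma nat_mul_pow_pred_le {R : ℝ} (hR : 1 ≤ R) (n : ℕ) :
    n * R ^ (n - 1) ≤ (2 * R) ^ n := by
  rw [mul_pow]
  have hn : (n : ℝ) ≤ 2 ^ n := by exact_mod_cast Nat.lt_two_pow_self.le
  have hpow : R ^ (n - 1) ≤ R ^ n := pow_le_pow_right₀ hR (Nat.sub_le n 1)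
  gcongr

lemma summable_norm_mul_nat_mul_pow_pred {c : ℕ → ℂ} (hc : ∀ z : ℂ, Summable fun n => c n * z ^ n)
    {R : ℝ} (hR : 1 ≤ R) : Summable fun n : ℕ => ‖c n‖ * (n * R ^ (n - 1)) := by
  refine (hc ((2 * R : ℝ) : ℂ)).norm.of_nonneg_of_le (fun n => by positivity) fun n => ?_
  rw [norm_mul, norm_pow, Complex.norm_real, Real.norm_of_nonneg (by positivity)]
  gcongr
  exact nat_mul_pow_pred_le hR n

lemma summable_derivCoeff {c : ℕ → ℂ} (hc : ∀ z : ℂ, Summable fun n => c n * z ^ n) (z : ℂ) :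
    Summable fun n => derivCoeff c n * z ^ n := by
  have h := (summable_nat_add_iff 1).2
    (summable_norm_mul_nat_mul_pow_pred hc (le_max_left 1 ‖z‖))
  refine h.of_norm_bounded fun n => ?_
  have hn : ‖(n : ℂ) + 1‖ = n + 1 := by exact_mod_cast Complex.norm_natCast (n + 1)
  rw [derivCoeff, norm_mul, norm_mul, norm_pow, hn, Nat.add_sub_cancel, Nat.cast_add_one,
    mul_comm ((n : ℝ) + 1), mul_assoc]
  gcongr
  exact le_max_right _ _

lemma hasDerivAt_tsum_mul_pow {c : ℕ → ℂ} (hc : ∀ z : ℂ, Summable fun n => c n * z ^ n) (z : ℂ) :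
    HasDerivAt (fun z => ∑' n, c n * z ^ n) (∑' n, derivCoeff c n * z ^ n) z := by
  have hR : (1 : ℝ) ≤ ‖z‖ + 1 := by linarith [norm_nonneg z]
  have hu := summable_norm_mul_nat_mul_pow_pred hc hR
  have hbound : ∀ (n : ℕ) (y : ℂ), y ∈ Metric.ball (0 : ℂ) (‖z‖ + 1) →
      ‖c n * (n * y ^ (n - 1))‖ ≤ ‖c n‖ * (n * (‖z‖ + 1) ^ (n - 1)) := by
    intro n y hy
    rw [norm_mul, norm_mul, norm_pow, Complex.norm_natCast]
    gcongr
    exact (mem_ball_zero_iff.1 hy).le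
  have hz : z ∈ Metric.ball (0 : ℂ) (‖z‖ + 1) := by simp
  have h := hasDerivAt_tsum_of_isPreconnected hu Metric.isOpen_ball
    (convex_ball (0 : ℂ) (‖z‖ + 1)).isPreconnected
    (fun n y _ => (hasDerivAt_pow n y).const_mul (c n)) hbound hz (hc z) hz
  suffices heq : ∑' n : ℕ, c n * (n * z ^ (n - 1)) = ∑' n, derivCoeff c n * z ^ n from heq ▸ h
  rw [(hu.of_norm_bounded fun n => hbound n z hz).tsum_eq_zero_add]
  simp only [derivCoeff, Nat.cast_zero, zero_mul, mul_zero, zero_add, Nat.add_sub_cancel,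
    Nat.cast_add_one]
  exact tsum_congr fun n => by ring

/-- The operator `f ↦ z f″ + f′` acts on power series by `c n ↦ (n + 1) ^ 2 * c (n + 1)`. -/
lemma hasSum_mul_deriv_deriv_add_deriv {c : ℕ → ℂ}
    (hc : ∀ z : ℂ, Summable fun n => c n * z ^ n) (z : ℂ) :
    HasSum (fun n : ℕ => (n + 1) ^ 2 * c (n + 1) * z ^ n)
      (z * ∑' n, derivCoeff (derivCoeff c) n * z ^ n + ∑' n, derivCoeff c n * z ^ n) := by
  have h₁ := summable_derivCoeff hc
  have h₂ : HasSum (fun n : ℕ => n * derivCoeff c n * z ^ n)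
      (z * ∑' n, derivCoeff (derivCoeff c) n * z ^ n) := by
    rw [← hasSum_nat_add_iff' 1]
    simp only [Finset.range_one, Finset.sum_singleton, Nat.cast_zero, zero_mul, sub_zero]
    refine ((summable_derivCoeff h₁ z).hasSum.mul_left z).congr_fun fun n => ?_
    rw [derivCoeff.eq_1 (derivCoeff c)]
    push_cast
    ring
  refine (h₂.add (h₁ z).hasSum).congr_fun fun n => ?_
  rw [derivCoeff]
  ring

lemma aCoef_eq (n : ℕ) : aCoef n = 2 * Real.eulerMascheroniConstant - 2 * harmonic n := by
  have hn : (n.factorial : ℝ) ≠ 0 := by positivity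
  rw [aCoef, Real.deriv_Gamma_nat, Real.Gamma_nat_eq_factorial]
  field_simp
  ring

lemma aCoef_succ (n : ℕ) : aCoef (n + 1) = aCoef n - 2 / (n + 1) := by
  rw [aCoef_eq, aCoef_eq, harmonic_succ]
  push_cast
  ring

lemma abs_aCoef_le (n : ℕ) : |aCoef n| ≤ |aCoef 0| + 2 * n := by
  induction n with
  | zero => simp
  | succ n ih =>
    have h : |(2 : ℝ) / (n + 1)| ≤ 2 := by
      rw [abs_of_nonneg (by positivity)]
      exact div_le_self zero_le_two (by linarith [n.cast_nonneg (α := ℝ)])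
    rw [aCoef_succ]
    push_cast
    linarith [abs_sub (aCoef n) (2 / ((n : ℝ) + 1))]

/-- The Taylor coefficients of `Phi lam`. -/
noncomputable def phiCoeff (lam : ℂ) (n : ℕ) : ℂ := lam ^ n / (4 ^ n * (n.factorial : ℂ) ^ 2)

lemma phiCoeff_succ (lam : ℂ) (n : ℕ) :
    4 * ((n + 1) ^ 2 * phiCoeff lam (n + 1)) = lam * phiCoeff lam n := by
  have hn : (n : ℂ) + 1 ≠ 0 := n.cast_add_one_ne_zero
  have hf : (n.factorial : ℂ) ≠ 0 := by exact_mod_cast n.factorial_ne_zero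
  rw [phiCoeff, phiCoeff, Nat.factorial_succ]
  push_cast
  field_simp
  ring

lemma norm_phiCoeff_le (lam : ℂ) (n : ℕ) : ‖phiCoeff lam n‖ ≤ ‖lam‖ ^ n / n.factorial := by
  have hf : (1 : ℝ) ≤ n.factorial := by exact_mod_cast n.factorial_pos
  have h4 : (1 : ℝ) ≤ 4 ^ n := one_le_pow₀ (by norm_num)
  simp only [phiCoeff, norm_div, norm_mul, norm_pow, Complex.norm_natCast, Complex.norm_ofNat]
  gcongr
  nlinarith

lemma summable_mul_phiCoeff {b : ℕ → ℂ} {K : ℝ} (hb : ∀ n, ‖b n‖ ≤ K * 2 ^ n) (lam z : ℂ) :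
    Summable fun n => b n * phiCoeff lam n * z ^ n := by
  refine ((Real.summable_pow_div_factorial (2 * ‖lam‖ * ‖z‖)).mul_left K).of_norm_bounded
    fun n => ?_
  have hK : 0 ≤ K * 2 ^ n := (norm_nonneg _).trans (hb n)
  rw [norm_mul, norm_mul, norm_pow]
  calc ‖b n‖ * ‖phiCoeff lam n‖ * ‖z‖ ^ n
      ≤ K * 2 ^ n * (‖lam‖ ^ n / n.factorial) * ‖z‖ ^ n := by
        gcongr
        exacts [hb n, norm_phiCoeff_le lam n]
    _ = K * ((2 * ‖lam‖ * ‖z‖) ^ n / n.factorial) := by ring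

lemma summable_phiCoeff (lam z : ℂ) : Summable fun n => phiCoeff lam n * z ^ n := by
  have hb : ∀ n : ℕ, ‖(1 : ℂ)‖ ≤ 1 * 2 ^ n := fun n => by
    simpa using one_le_pow₀ (n := n) (one_le_two (α := ℝ))
  simpa using summable_mul_phiCoeff hb lam z

/-- The Taylor coefficients of `wFun lam`. -/
noncomputable def wCoeff (lam : ℂ) (n : ℕ) : ℂ := aCoef n * phiCoeff lam n

lemma summable_wCoeff (lam z : ℂ) : Summable fun n => wCoeff lam n * z ^ n := by
  refine summable_mul_phiCoeff (K := |aCoef 0| + 2) (fun n => ?_) lam z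
  have hn : (n : ℝ) ≤ 2 ^ n := by exact_mod_cast Nat.lt_two_pow_self.le
  have h1 : (1 : ℝ) ≤ 2 ^ n := one_le_pow₀ one_le_two
  rw [Complex.norm_real, Real.norm_eq_abs]
  nlinarith [abs_aCoef_le n, abs_nonneg (aCoef 0)]

lemma wCoeff_succ (lam : ℂ) (n : ℕ) :
    4 * ((n + 1) ^ 2 * wCoeff lam (n + 1)) =
      lam * wCoeff lam n - 8 * derivCoeff (phiCoeff lam) n := by
  have hn : (n : ℂ) + 1 ≠ 0 := n.cast_add_one_ne_zero
  rw [wCoeff, wCoeff, derivCoeff, aCoef_succ, mul_left_comm lam, ← phiCoeff_succ]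
  push_cast
  field_simp
  ring

lemma Phi_eq_tsum (lam : ℂ) : Phi lam = fun z => ∑' n, phiCoeff lam n * z ^ n := by
  ext z
  exact tsum_congr fun n => by rw [phiCoeff, mul_pow]; ring

lemma wFun_eq_tsum (lam : ℂ) : wFun lam = fun z => ∑' n, wCoeff lam n * z ^ n := by
  ext z
  exact tsum_congr fun n => by rw [wCoeff, phiCoeff, mul_pow]; ring

lemma Phi_bessel (lam z : ℂ) :
    4 * (z * (∑' n, derivCoeff (derivCoeff (phiCoeff lam)) n * z ^ n) +
      ∑' n, derivCoeff (phiCoeff lam) n * z ^ n) = lam * Phi lam z := by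
  refine ((hasSum_mul_deriv_deriv_add_deriv (summable_phiCoeff lam) z).mul_left 4).unique ?_
  rw [Phi_eq_tsum]
  refine ((summable_phiCoeff lam z).hasSum.mul_left lam).congr_fun fun n => ?_
  linear_combination z ^ n * phiCoeff_succ lam n

lemma wFun_bessel (lam z : ℂ) :
    4 * (z * (∑' n, derivCoeff (derivCoeff (wCoeff lam)) n * z ^ n) +
      ∑' n, derivCoeff (wCoeff lam) n * z ^ n) =
      lam * wFun lam z - 8 * ∑' n, derivCoeff (phiCoeff lam) n * z ^ n := by
  refine ((hasSum_mul_deriv_deriv_add_deriv (summable_wCoeff lam) z).mul_left 4).unique ?_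
  rw [wFun_eq_tsum]
  refine (((summable_wCoeff lam z).hasSum.mul_left lam).sub
    ((summable_derivCoeff (summable_phiCoeff lam) z).hasSum.mul_left 8)).congr_fun fun n => ?_
  linear_combination z ^ n * wCoeff_succ lam n

lemma hasDerivAt_add_log_mul {f g : ℂ → ℂ} {f' g' z : ℂ} (hz : z ∈ Complex.slitPlane)
    (hf : HasDerivAt f f' z) (hg : HasDerivAt g g' z) :
    HasDerivAt (fun y => f y + Complex.log y * g y)
      (f' + (z⁻¹ * g z + Complex.log z * g')) z :=
  hf.add ((Complex.hasDerivAt_log hz).mul hg)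

/-- `W_λ` satisfies `L_c W_λ = λ W_λ`, i.e. `4 (z W_λ″(z) + W_λ′(z)) = λ W_λ(z)`,
on the slit plane `ℂ ∖ (−∞, 0]`. -/
theorem W_bessel (lam : ℂ) (z : ℂ) (hz : z ∈ Complex.slitPlane) :
    4 * (z * deriv (deriv (W lam)) z + deriv (W lam) z) = lam * W lam z := by
  have hz0 : z ≠ 0 := Complex.slitPlane_ne_zero hz
  set p₁ : ℂ → ℂ := fun z => ∑' n, derivCoeff (phiCoeff lam) n * z ^ n
  set p₂ : ℂ → ℂ := fun z => ∑' n, derivCoeff (derivCoeff (phiCoeff lam)) n * z ^ n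
  set w₁ : ℂ → ℂ := fun z => ∑' n, derivCoeff (wCoeff lam) n * z ^ n
  set w₂ : ℂ → ℂ := fun z => ∑' n, derivCoeff (derivCoeff (wCoeff lam)) n * z ^ n
  have hp : ∀ y, HasDerivAt (Phi lam) (p₁ y) y := fun y => by
    rw [Phi_eq_tsum]
    exact hasDerivAt_tsum_mul_pow (summable_phiCoeff lam) y
  have hw : ∀ y, HasDerivAt (wFun lam) (w₁ y) y := fun y => by
    rw [wFun_eq_tsum]
    exact hasDerivAt_tsum_mul_pow (summable_wCoeff lam) y
  have hp' : HasDerivAt p₁ (p₂ z) z :=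
    hasDerivAt_tsum_mul_pow (summable_derivCoeff (summable_phiCoeff lam)) z
  have hw' : HasDerivAt w₁ (w₂ z) z :=
    hasDerivAt_tsum_mul_pow (summable_derivCoeff (summable_wCoeff lam)) z
  have hW : ∀ y ∈ Complex.slitPlane,
      deriv (W lam) y = w₁ y + (y⁻¹ * Phi lam y + Complex.log y * p₁ y) :=
    fun y hy => (hasDerivAt_add_log_mul hy (hw y) (hp y)).deriv
  have hW' : deriv (deriv (W lam)) z = w₂ z + ((-(z ^ 2)⁻¹ * Phi lam z + z⁻¹ * p₁ z) +
      (z⁻¹ * p₁ z + Complex.log z * p₂ z)) := by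
    have heq := Filter.eventuallyEq_of_mem (Complex.isOpen_slitPlane.mem_nhds hz) hW
    rw [heq.deriv_eq]
    exact (hw'.add (((hasDerivAt_inv hz0).mul (hp z)).add
      ((Complex.hasDerivAt_log hz).mul hp'))).deriv
  have hPhi : 4 * (z * p₂ z + p₁ z) = lam * Phi lam z := Phi_bessel lam z
  have hwFun : 4 * (z * w₂ z + w₁ z) = lam * wFun lam z - 8 * p₁ z := wFun_bessel lam z
  rw [hW', hW z hz, W]
  field_simp
  linear_combination z * hwFun + z * Complex.log z * hPhi
end

section
/- Let u₁, u₂ ∈ ℝ ∖ {0} and ε₁, ε₂ ∈ {−1, +1} with ε₁u₁² ≠ ε₂u₂². Set Y = diag(u₁, u₂) and Z = diag(ε₁u₁, ε₂u₂) in M₂(ℝ). Then for invertible matrices A, B ∈ GL₂(ℝ), one has A·Y = Y·B and B·Z = Z·A if and only if there exist α, β ∈ ℝ ∖ {0} with A = B = diag(α, β). (Equivalently, the centralizer in H = GL(2,ℝ)×GL(2,ℝ) of the regular element X_ε(u₁,u₂) of 𝔮 with blocks Y, Z consists exactly of the pairs (diag(α,β), diag(α,β)).) -/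
/-- If `A * diag(y) = diag(y) * B` and `B * diag(z) = diag(z) * A`, then `A` vanishes at the
positions `(i, j)` with `y i * z i ≠ y j * z j`. -/
theorem apply_eq_zero_of_intertwines_diagonal {n R : Type*} [Fintype n] [DecidableEq n]
    [CommRing R] [IsDomain R] {A B : Matrix n n R} {y z : n → R}
    (hY : A * Matrix.diagonal y = Matrix.diagonal y * B)
    (hZ : B * Matrix.diagonal z = Matrix.diagonal z * A) {i j : n}
    (hij : y i * z i ≠ y j * z j) : A i j = 0 := by
  have h₁ := congrFun (congrFun hY i) j
  have h₂ := congrFun (congrFun hZ i) j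
  rw [Matrix.mul_diagonal, Matrix.diagonal_mul] at h₁ h₂
  refine (mul_eq_zero.mp ?_).resolve_left (sub_ne_zero.mpr hij)
  linear_combination (-z j) * h₁ - y i * h₂

/-- If `A * diag(y) = diag(y) * B`, where `A` is diagonal and `y` has no zero entry, then
`B = A`. -/
theorem eq_diagonal_of_diagonal_intertwines {n R : Type*} [Fintype n] [DecidableEq n]
    [CommRing R] [IsDomain R] {B : Matrix n n R} {y d : n → R} (hy : ∀ i, y i ≠ 0)
    (hY : Matrix.diagonal d * Matrix.diagonal y = Matrix.diagonal y * B) :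
    B = Matrix.diagonal d := by
  ext i j
  apply mul_left_cancel₀ (hy i)
  rw [← Matrix.diagonal_mul, ← hY, ← Matrix.diagonal_mul, Matrix.diagonal_mul_diagonal,
    Matrix.diagonal_mul_diagonal]
  simp only [mul_comm]

/-- Centralizer of the regular element `X_ε(u₁,u₂)` in `H = GL(2,ℝ) × GL(2,ℝ)`:
with `Y = diag(u₁,u₂)`, `Z = diag(ε₁u₁, ε₂u₂)` and `ε₁u₁² ≠ ε₂u₂²`, a pair of
invertible matrices `(A,B)` satisfies `AY = YB` and `BZ = ZA` if and only if
`A = B = diag(α,β)` with `α, β ≠ 0`. -/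
theorem centralizer_regular_element (u₁ u₂ : ℝ) (hu₁ : u₁ ≠ 0) (hu₂ : u₂ ≠ 0)
    (ε₁ ε₂ : ℝ) (hε₁ : ε₁ = -1 ∨ ε₁ = 1) (hε₂ : ε₂ = -1 ∨ ε₂ = 1)
    (hreg : ε₁ * u₁ ^ 2 ≠ ε₂ * u₂ ^ 2)
    (A B : Matrix (Fin 2) (Fin 2) ℝ) (hA : IsUnit A) (hB : IsUnit B) :
    (A * Matrix.diagonal ![u₁, u₂] = Matrix.diagonal ![u₁, u₂] * B ∧
      B * Matrix.diagonal ![ε₁ * u₁, ε₂ * u₂] = Matrix.diagonal ![ε₁ * u₁, ε₂ * u₂] * A) ↔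
    ∃ a b : ℝ, a ≠ 0 ∧ b ≠ 0 ∧
      A = Matrix.diagonal ![a, b] ∧ B = Matrix.diagonal ![a, b] := by
  constructor
  · rintro ⟨hY, hZ⟩
    have h01 : A 0 1 = 0 := apply_eq_zero_of_intertwines_diagonal hY hZ fun h => hreg <| by
      simp only [Matrix.cons_val_zero, Matrix.cons_val_one] at h
      linear_combination h
    have h10 : A 1 0 = 0 := apply_eq_zero_of_intertwines_diagonal hY hZ fun h => hreg <| by
      simp only [Matrix.cons_val_zero, Matrix.cons_val_one] at h
      linear_combination -h
    have hAd : A = Matrix.diagonal ![A 0 0, A 1 1] := by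
      ext i j
      fin_cases i <;> fin_cases j <;> simp [h01, h10]
    have hdet : A 0 0 * A 1 1 ≠ 0 := by
      have h := ((Matrix.isUnit_iff_isUnit_det A).mp hA).ne_zero
      rwa [Matrix.det_fin_two, h01, zero_mul, sub_zero] at h
    refine ⟨A 0 0, A 1 1, left_ne_zero_of_mul hdet, right_ne_zero_of_mul hdet, hAd, ?_⟩
    rw [hAd] at hY
    exact eq_diagonal_of_diagonal_intertwines (by simp [Fin.forall_fin_two, hu₁, hu₂]) hY
  · rintro ⟨a, b, -, -, rfl, rfl⟩
    exact ⟨Matrix.commute_diagonal _ _, Matrix.commute_diagonal _ _⟩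
end
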